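/- Let MO(M_i)_{i=1}^n be the MO protocol, the free VLSM composition of the MO components M_1, …, M_n of addresses 1, …, n. Then every component M_i is a validator for MO(M_i)_{i=1}^n: for every constrained state s of M_i and every constrained transition of M_i from s with label l, input message m, output state s' and output message m', there exists a valid transition of MO(M_i)_{i=1}^n with label ⟨i, l⟩, input message m and output message m' whose input and output composite states have i-th components s and s' respectively. -/

import Mathlib

set_option autoImplicit false

universe u v w

/-- A validating labelled state transition and message production system (VLSM):
labels, a nonempty set of initial states, initial messages, a total transition
function and a validity constraint.  `Option M` plays the role of `M ∪ {⊥}`. -/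
structure VLSM (L : Type u) (S : Type v) (M : Type w) where
  init : Set S
  init_ne : init.Nonempty
  initMsg : Set M
  tau : L → S → Option M → S × Option M
  beta : L → S → Option M → Prop

/-- A transition record: label, source state, input message, target state, output message. -/
structure VTrans (L : Type u) (S : Type v) (M : Type w) where
  lbl : L
  src : S
  msg : Option M
  dst : S
  out : Option M

variable {L : Type u} {S : Type v} {M : Type w}

/-- `Chain s tr sf`: the transitions of `tr` link up, starting at `s` and ending at `sf`. -/
def Chain : S → List (VTrans L S M) → S → Prop
  | s, [], sf => s = sf
  | s, t :: ts, sf => t.src = s ∧ Chain t.dst ts sf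

namespace VLSM

/-- `t` is an actual transition of `V` (the transition function agrees with `t`). -/
def IsTrans (V : VLSM L S M) (t : VTrans L S M) : Prop :=
  V.tau t.lbl t.src t.msg = (t.dst, t.out)

/-- `t` is a constrained transition of `V`. -/
def IsConstrainedTrans (V : VLSM L S M) (t : VTrans L S M) : Prop :=
  V.IsTrans t ∧ V.beta t.lbl t.src t.msg

/-- `tr` is a constrained trace of `V` reaching the state `sf`. -/
def ConstrainedTraceTo (V : VLSM L S M) (tr : List (VTrans L S M)) (sf : S) : Prop :=
  (∀ t ∈ tr, V.IsConstrainedTrans t) ∧ ∃ s0 ∈ V.init, Chain s0 tr sf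

/-- A state is constrained if some constrained trace reaches it. -/
def ConstrainedState (V : VLSM L S M) (s : S) : Prop :=
  ∃ tr, V.ConstrainedTraceTo tr s

/-- Constrained reachability, defined inductively (a state is constrained iff it is
reachable from an initial state by constrained transitions). -/
inductive ReachState (V : VLSM L S M) : S → Prop where
  | init {s} : s ∈ V.init → ReachState V s
  | step {l s m} : ReachState V s → V.beta l s m → ReachState V (V.tau l s m).1

mutual
  /-- Valid states of a VLSM. -/
  inductive ValidState (V : VLSM L S M) : S → Prop where
    | init {s} : s ∈ V.init → ValidState V s
    | step {l s m} : ValidState V s → ValidOMsg V m → V.beta l s m →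
        ValidState V (V.tau l s m).1
  /-- Valid optional messages of a VLSM (`none` is always valid). -/
  inductive ValidOMsg (V : VLSM L S M) : Option M → Prop where
    | none : ValidOMsg V Option.none
    | init {m} : m ∈ V.initMsg → ValidOMsg V (some m)
    | step {l s m} : ValidState V s → ValidOMsg V m → V.beta l s m →
        ValidOMsg V (V.tau l s m).2
end

/-- `t` is a valid transition of `V`. -/
def IsValidTrans (V : VLSM L S M) (t : VTrans L S M) : Prop :=
  V.IsConstrainedTrans t ∧ V.ValidState t.src ∧ V.ValidOMsg t.msg

/-- `tr` is a valid trace of `V` reaching the state `sf`. -/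
def ValidTraceTo (V : VLSM L S M) (tr : List (VTrans L S M)) (sf : S) : Prop :=
  (∀ t ∈ tr, V.IsValidTrans t) ∧ ∃ s0 ∈ V.init, Chain s0 tr sf

/-- `tr` is a valid trace of `V`. -/
def IsValidTrace (V : VLSM L S M) (tr : List (VTrans L S M)) : Prop :=
  ∃ sf, V.ValidTraceTo tr sf

end VLSM

/-- The message `m` is emitted (sent) on the trace `tr`. -/
def EmittedOn (tr : List (VTrans L S M)) (m : M) : Prop := ∃ t ∈ tr, t.out = some m

/-- The message `m` is received on the trace `tr`. -/
def ReceivedOn (tr : List (VTrans L S M)) (m : M) : Prop := ∃ t ∈ tr, t.msg = some m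

/-- `sent` is a sent-oracle for `V`: at every constrained state `s`, `sent s m` holds
iff `m` is emitted on every constrained trace reaching `s`. -/
def IsSentOracle (V : VLSM L S M) (sent : S → M → Prop) : Prop :=
  ∀ s, V.ConstrainedState s → ∀ m,
    (sent s m ↔ ∀ tr, V.ConstrainedTraceTo tr s → EmittedOn tr m)

/-- `recv` is a received-oracle for `V`. -/
def IsReceivedOracle (V : VLSM L S M) (recv : S → M → Prop) : Prop :=
  ∀ s, V.ConstrainedState s → ∀ m,
    (recv s m ↔ ∀ tr, V.ConstrainedTraceTo tr s → ReceivedOn tr m)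

/-- The full node assumption: whenever receiving `m` is allowed by the validity
constraint, every direct dependency of `m` has been directly observed in the state. -/
def FullNodeAssumption (V : VLSM L S M) (dep : M → M → Prop)
    (sent recv : S → M → Prop) : Prop :=
  ∀ l s m, V.beta l s (some m) → ∀ m', dep m' m → sent s m' ∨ recv s m'

section Composition

variable {ι : Type*} [DecidableEq ι] {Lf : ι → Type*} {Sf : ι → Type*}

/-- The constrained composition of an indexed family of VLSMs over the same
message set, under the composition constraint `φ`. -/
noncomputable def comp (V : ∀ i, VLSM (Lf i) (Sf i) M)
    (φ : (Σ i, Lf i) → (∀ i, Sf i) → Option M → Prop) :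
    VLSM (Σ i, Lf i) (∀ i, Sf i) M where
  init := {σ | ∀ i, σ i ∈ (V i).init}
  init_ne := ⟨fun i => ((V i).init_ne).choose, fun i => ((V i).init_ne).choose_spec⟩
  initMsg := ⋃ i, (V i).initMsg
  tau := fun l σ m =>
    (Function.update σ l.1 ((V l.1).tau l.2 (σ l.1) m).1, ((V l.1).tau l.2 (σ l.1) m).2)
  beta := fun l σ m => (V l.1).beta l.2 (σ l.1) m ∧ φ l σ m

/-- The free composition of an indexed family of VLSMs over the same message set. -/
noncomputable def freeComp (V : ∀ i, VLSM (Lf i) (Sf i) M) :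
    VLSM (Σ i, Lf i) (∀ i, Sf i) M :=
  comp V fun _ _ _ => True

/-- Component `j` is a validator for the composite VLSM `W`: every constrained
transition from a constrained state of `V j` lifts to a valid transition of `W`
with matching `j`-th state components and matching input/output messages. -/
def IsValidatorAt (V : ∀ i, VLSM (Lf i) (Sf i) M)
    (W : VLSM (Σ i, Lf i) (∀ i, Sf i) M) (j : ι) : Prop :=
  ∀ l s m, (V j).ConstrainedState s → (V j).beta l s m →
    ∃ σ : ∀ i, Sf i, σ j = s ∧
      W.IsValidTrans ⟨⟨j, l⟩, σ, m, (W.tau ⟨j, l⟩ σ m).1, (W.tau ⟨j, l⟩ σ m).2⟩ ∧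
      (W.tau ⟨j, l⟩ σ m).1 j = ((V j).tau l s m).1 ∧
      (W.tau ⟨j, l⟩ σ m).2 = ((V j).tau l s m).2

/-- The induced `j`-th projection of a composite VLSM `W`: the same VLSM as the
component `Vj`, except that its initial messages are all valid messages of `W`. -/
def projV {L' : Type*} {S' : Type*} {L2 : Type*} {S2 : Type*}
    (Vj : VLSM L' S' M) (W : VLSM L2 S2 M) : VLSM L' S' M :=
  { Vj with initMsg := {m | W.ValidOMsg (some m)} }

/-- The projection of a composite trace on component `j`. -/
def projTrace (j : ι) (tr : List (VTrans (Σ i, Lf i) (∀ i, Sf i) M)) :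
    List (VTrans (Lf j) (Sf j) M) :=
  tr.filterMap fun t =>
    if h : t.lbl.1 = j then some ⟨h ▸ t.lbl.2, t.src j, t.msg, t.dst j, t.out⟩ else none

/-- The composition constraint of the fixed-set message-equivocation model:
the only message-equivocations allowed are among the components of `E`. -/
def phiM (sender : M → ι) (sent : ∀ i, Sf i → M → Prop) (E : Set ι) :
    (Σ i, Lf i) → (∀ i, Sf i) → Option M → Prop :=
  fun l σ m => ∀ mm, m = some mm →
    (sent (sender mm) (σ (sender mm)) mm ∨ (l.1 ∈ E ∧ sender mm ∈ E))

end Composition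

/-- Labels of the equivocating VLSM associated to a VLSM: act as the `i`-th copy,
duplicate the `i`-th copy, or spawn a new machine after position `i` (1-based). -/
inductive ELabel (L : Type u) (S : Type v) where
  | act (i : ℕ) (l : L)
  | dup (i : ℕ)
  | new (i : ℕ) (s : S)

/-- The equivocating VLSM associated to a VLSM `V`: its states are (nonempty) lists
of states of `V`, and it can fork itself or spawn fresh copies at any moment. -/
noncomputable def eVLSM (V : VLSM L S M) : VLSM (ELabel L S) (List S) M where
  init := {γ | ∃ s ∈ V.init, γ = [s]}
  init_ne := ⟨[V.init_ne.choose], V.init_ne.choose, V.init_ne.choose_spec, rfl⟩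
  initMsg := V.initMsg
  tau := fun lab γ m =>
    match lab with
    | .act i l =>
      match γ[i - 1]? with
      | some s => (γ.set (i - 1) (V.tau l s m).1, (V.tau l s m).2)
      | none => (γ, Option.none)
    | .dup i =>
      match γ[i - 1]? with
      | some s => (γ.take i ++ s :: γ.drop i, Option.none)
      | none => (γ, Option.none)
    | .new i s0 => (γ.take i ++ s0 :: γ.drop i, Option.none)
  beta := fun lab γ m =>
    match lab with
    | .act i l => 1 ≤ i ∧ i ≤ γ.length ∧ ∃ s, γ[i - 1]? = some s ∧ V.beta l s m
    | .dup i => 1 ≤ i ∧ i ≤ γ.length ∧ m = Option.none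
    | .new i s0 => 1 ≤ i ∧ i ≤ γ.length ∧ m = Option.none ∧ s0 ∈ V.init

/-- The two labels of UMO/MO/ELMO components. -/
inductive UL where
  | send
  | recv
deriving DecidableEq

/-- States (= messages) of UMO components: a finite list of message observations
together with an address. -/
inductive UState where
  | mk (obs : List (UL × UState)) (addr : ℕ)

/-- The list of message observations of a state. -/
def UState.obs : UState → List (UL × UState)
  | .mk o _ => o

/-- The address of a state. -/
def UState.addr : UState → ℕ
  | .mk _ i => i

/-- The set of messages observed as sent in a state. -/
def UState.sentMessages (s : UState) : Set UState := {m | (UL.send, m) ∈ s.obs}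

/-- The set of messages observed as received in a state. -/
def UState.receivedMessages (s : UState) : Set UState := {m | (UL.recv, m) ∈ s.obs}

/-- The set of messages observed in a state. -/
def UState.messages (s : UState) : Set UState := {m | ∃ l, (l, m) ∈ s.obs}

/-- The validity constraint of UMO components. -/
def betaUMO (l : UL) (_ : UState) (m : Option UState) : Prop :=
  (l = UL.send ∧ m = Option.none) ∨ (l = UL.recv ∧ m ≠ Option.none)

/-- The transition function of UMO (and MO, ELMO) components. -/
def tauUMO (l : UL) (s : UState) (m : Option UState) : UState × Option UState :=
  match l, m with
  | .send, Option.none => (UState.mk (s.obs ++ [(UL.send, s)]) s.addr, some s)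
  | .recv, some mm => (UState.mk (s.obs ++ [(UL.recv, mm)]) s.addr, Option.none)
  | _, _ => (s, m)

/-- The UMO component of address `i`. -/
noncomputable def UMO (i : ℕ) : VLSM UL UState UState where
  init := {UState.mk [] i}
  init_ne := ⟨UState.mk [] i, rfl⟩
  initMsg := ∅
  tau := tauUMO
  beta := betaUMO

/-- The UMO protocol: the free composition of the UMO components of addresses 1,…,n. -/
noncomputable def UMOProtocol (n : ℕ) : VLSM (Σ _ : Fin n, UL) (Fin n → UState) UState :=
  freeComp fun k : Fin n => UMO (k.1 + 1)

/-- The message-validity predicate `ψ_msg_valid` of MO components, as an inductive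
predicate capturing its recursive definition on the last observation. -/
inductive MsgValid (n : ℕ) : UState → Prop where
  | nil {j} : 1 ≤ j → j ≤ n → MsgValid n (.mk [] j)
  | snocSend {o j} : MsgValid n (.mk o j) →
      MsgValid n (.mk (o ++ [(UL.send, .mk o j)]) j)
  | snocRecv {o j op jp} : MsgValid n (.mk o j) → MsgValid n (.mk op jp) →
      MsgValid n (.mk (o ++ [(UL.recv, .mk op jp)]) j)

/-- The MO component of address `i` (with component addresses ranging over 1,…,n). -/
noncomputable def MO (n i : ℕ) : VLSM UL UState UState :=
  { UMO i with
    beta := fun l s m =>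
      betaUMO l s m ∧ (l = UL.recv → ∀ mm, m = some mm → MsgValid n mm) }

/-- The MO protocol: the free composition of the MO components of addresses 1,…,n. -/
noncomputable def MOProtocol (n : ℕ) : VLSM (Σ _ : Fin n, UL) (Fin n → UState) UState :=
  freeComp fun k : Fin n => MO n (k.1 + 1)

/-- The composite state of the MO protocol whose `k`-th component is `s` and whose other
components are initial. -/
def MOLift (n : ℕ) (k : Fin n) (s : UState) : Fin n → UState :=
  Function.update (fun j : Fin n => UState.mk [] (j.1 + 1)) k s

@[simp]
theorem MOLift_self (n : ℕ) (k : Fin n) (s : UState) : MOLift n k s k = s := by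
  simp [MOLift]

theorem MOProtocol_tau_MOLift (n : ℕ) (k : Fin n) (l : UL) (s : UState) (m : Option UState) :
    (MOProtocol n).tau ⟨k, l⟩ (MOLift n k s) m =
      (MOLift n k (tauUMO l s m).1, (tauUMO l s m).2) := by
  simp [MOProtocol, freeComp, comp, MO, UMO, MOLift]

theorem MOProtocol_beta_MOLift {n : ℕ} {k : Fin n} {l : UL} {s : UState} {m : Option UState}
    (h : (MO n (k.1 + 1)).beta l s m) : (MOProtocol n).beta ⟨k, l⟩ (MOLift n k s) m := by
  refine ⟨?_, trivial⟩
  simpa using h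

theorem validState_MOLift_tauUMO {n : ℕ} {k : Fin n} {l : UL} {s : UState} {m : Option UState}
    (hs : (MOProtocol n).ValidState (MOLift n k s)) (hm : (MOProtocol n).ValidOMsg m)
    (h : (MO n (k.1 + 1)).beta l s m) :
    (MOProtocol n).ValidState (MOLift n k (tauUMO l s m).1) := by
  have := VLSM.ValidState.step hs hm (MOProtocol_beta_MOLift h)
  rwa [MOProtocol_tau_MOLift] at this

theorem validOMsg_of_validState_MOLift {n : ℕ} {k : Fin n} {s : UState}
    (hs : (MOProtocol n).ValidState (MOLift n k s)) : (MOProtocol n).ValidOMsg (some s) := by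
  have hb : (MO n (k.1 + 1)).beta UL.send s none := ⟨Or.inl ⟨rfl, rfl⟩, nofun⟩
  have := VLSM.ValidOMsg.step hs .none (MOProtocol_beta_MOLift hb)
  rwa [MOProtocol_tau_MOLift] at this

theorem MsgValid.exists_validState_MOLift {n : ℕ} {s : UState} (h : MsgValid n s) :
    ∃ k : Fin n, s.addr = k.1 + 1 ∧ (MOProtocol n).ValidState (MOLift n k s) := by
  induction h with
  | @nil j h1 h2 =>
    refine ⟨⟨j - 1, by omega⟩, by simp [UState.addr]; omega, .init fun i => ?_⟩
    by_cases hi : i = ⟨j - 1, by omega⟩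
    · subst hi
      simp [MO, UMO]
      omega
    · simp [MOLift, hi, MO, UMO]
  | @snocSend o j _ ih =>
    obtain ⟨k, hk, hv⟩ := ih
    exact ⟨k, hk, validState_MOLift_tauUMO (l := .send) hv .none ⟨Or.inl ⟨rfl, rfl⟩, nofun⟩⟩
  | @snocRecv o j op jp _ hm ih ihm =>
    obtain ⟨k, hk, hv⟩ := ih
    obtain ⟨k', -, hv'⟩ := ihm
    refine ⟨k, hk, validState_MOLift_tauUMO (l := .recv) hv
      (validOMsg_of_validState_MOLift hv') ⟨Or.inr ⟨rfl, nofun⟩, ?_⟩⟩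
    rintro - _ ⟨⟩
    exact hm

theorem MsgValid.tauUMO {n i : ℕ} {l : UL} {s : UState} {m : Option UState}
    (hs : MsgValid n s) (h : (MO n i).beta l s m) : MsgValid n (tauUMO l s m).1 := by
  obtain ⟨o, j⟩ := s
  obtain ⟨⟨rfl, rfl⟩ | ⟨rfl, hm⟩, hv⟩ := h
  · exact .snocSend hs
  · obtain ⟨⟨op, jp⟩, rfl⟩ := Option.ne_none_iff_exists'.1 hm
    exact .snocRecv hs (hv rfl _ rfl)

theorem addr_tauUMO (l : UL) (s : UState) (m : Option UState) :
    (tauUMO l s m).1.addr = s.addr := by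
  cases l <;> cases m <;> rfl

theorem MsgValid.of_chain {n i : ℕ} {tr : List (VTrans UL UState UState)} {s sf : UState}
    (hs : MsgValid n s) (htr : ∀ t ∈ tr, (MO n i).IsConstrainedTrans t) (hc : Chain s tr sf) :
    MsgValid n sf ∧ sf.addr = s.addr := by
  induction tr generalizing s with
  | nil => cases hc; exact ⟨hs, rfl⟩
  | cons t ts ih =>
    obtain ⟨rfl, hc⟩ := hc
    obtain ⟨ht, hb⟩ := htr t List.mem_cons_self
    have hd : (_root_.tauUMO t.lbl t.src t.msg).1 = t.dst := congrArg Prod.fst ht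
    have := ih (hd ▸ hs.tauUMO hb) (fun t h => htr t (List.mem_cons_of_mem _ h)) hc
    rwa [← hd, addr_tauUMO] at this

theorem MsgValid.of_constrainedState {n : ℕ} {k : Fin n} {s : UState}
    (h : (MO n (k.1 + 1)).ConstrainedState s) : MsgValid n s ∧ s.addr = k.1 + 1 := by
  obtain ⟨tr, htr, _, rfl, hc⟩ := h
  exact MsgValid.of_chain (.nil (by omega) (by omega)) htr hc

/-- Every MO component is a validator for the MO protocol. -/
theorem MO_component_validating (n : ℕ) (k : Fin n) :
    IsValidatorAt (fun j : Fin n => MO n (j.1 + 1)) (MOProtocol n) k := by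
  intro l s m hs hb
  obtain ⟨hv, ha⟩ := MsgValid.of_constrainedState hs
  obtain ⟨k', hk', hσ⟩ := hv.exists_validState_MOLift
  obtain rfl : k' = k := Fin.ext (by omega)
  have hm : (MOProtocol n).ValidOMsg m := by
    obtain ⟨⟨-, rfl⟩ | ⟨rfl, hne⟩, hmv⟩ := hb
    · exact .none
    · obtain ⟨mm, rfl⟩ := Option.ne_none_iff_exists'.1 hne
      obtain ⟨_, -, h⟩ := (hmv rfl mm rfl).exists_validState_MOLift
      exact validOMsg_of_validState_MOLift h
  refine ⟨MOLift n k' s, MOLift_self n k' s, ⟨⟨rfl, MOProtocol_beta_MOLift hb⟩, hσ, hm⟩, ?_, ?_⟩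
  · rw [MOProtocol_tau_MOLift]
    exact MOLift_self n k' _
  · rw [MOProtocol_tau_MOLift]
    rfl
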